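/- arXiv:2512.11155 — 10 statements merged into one kernel-verified Lean document; each statement's English description precedes it below -/
import Mathlib

section
/- Along every solution of the reduced Hamiltonian system, the function t ↦ Ĩ₂(t) = p₂(t) + (C₀·r(t)²/2)·cos²θ₁(t) has derivative zero at every t ∈ J, i.e. Ĩ₂ is a first integral. -/
open Real

/-- Along every solution of the reduced Hamiltonian system, the function
`Ĩ₂(t) = p₂(t) + (C₀·r(t)²/2)·cos²θ₁(t)` has derivative zero at every `t ∈ J`,
i.e. `Ĩ₂` is a first integral. -/
theorem I2_is_first_integral
    (C₀ : ℝ) (hC₀ : C₀ ≠ 0) (J : Set ℝ) (hJopen : IsOpen J) (hJconn : J.OrdConnected)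
    (r θ₁ θ₂ θ₃ p_r p₁ p₂ p₃ : ℝ → ℝ)
    (hr_pos : ∀ t ∈ J, 0 < r t)
    (hθ₁_range : ∀ t ∈ J, 0 < θ₁ t ∧ θ₁ t < Real.pi / 2)
    (hr' : ∀ t ∈ J, HasDerivAt r (p_r t) t)
    (hθ₁' : ∀ t ∈ J, HasDerivAt θ₁ (p₁ t / (r t) ^ 2) t)
    (hθ₂' : ∀ t ∈ J, HasDerivAt θ₂
      (p₂ t / ((r t) ^ 2 * Real.cos (θ₁ t) ^ 2) - (p₂ t + p₃ t) / (1 + (r t) ^ 2)) t)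
    (hθ₃' : ∀ t ∈ J, HasDerivAt θ₃
      (p₃ t / ((r t) ^ 2 * Real.sin (θ₁ t) ^ 2) - (p₂ t + p₃ t) / (1 + (r t) ^ 2)) t)
    (hp_r' : ∀ t ∈ J, HasDerivAt p_r
      ((p₁ t) ^ 2 / (r t) ^ 3
        + ((p₂ t) ^ 2 / Real.cos (θ₁ t) ^ 2 + (p₃ t) ^ 2 / Real.sin (θ₁ t) ^ 2) / (r t) ^ 3
        - r t * (p₂ t + p₃ t) ^ 2 / (1 + (r t) ^ 2) ^ 2
        + C₀ * (p₂ t + p₃ t) / (r t * (1 + (r t) ^ 2))) t)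
    (hp₁' : ∀ t ∈ J, HasDerivAt p₁
      ((1 / (r t) ^ 2) *
        (p₃ t * ((r t) ^ 2 * C₀ + p₃ t / Real.sin (θ₁ t) ^ 2) * Real.cot (θ₁ t)
          - p₂ t * ((r t) ^ 2 * C₀ + p₂ t / Real.cos (θ₁ t) ^ 2) * Real.tan (θ₁ t))) t)
    (hp₂' : ∀ t ∈ J, HasDerivAt p₂
      (-C₀ * Real.cos (θ₁ t) * (r t * p_r t * Real.cos (θ₁ t) - p₁ t * Real.sin (θ₁ t))) t)
    (hp₃' : ∀ t ∈ J, HasDerivAt p₃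
      (-C₀ * Real.sin (θ₁ t) * (r t * p_r t * Real.sin (θ₁ t) + p₁ t * Real.cos (θ₁ t))) t) :
    ∀ t ∈ J, HasDerivAt (fun s => p₂ s + C₀ * (r s) ^ 2 / 2 * Real.cos (θ₁ s) ^ 2) 0 t := by
  intro t ht
  have hr : r t ≠ 0 := (hr_pos t ht).ne'
  have h := (hp₂' t ht).add
    (((((hr' t ht).pow 2).const_mul C₀).div_const 2).mul ((hθ₁' t ht).cos.pow 2))
  refine h.congr_deriv ?_
  simp only [Pi.pow_apply]
  field_simp
  ring
end

section
/- Along every solution of the reduced Hamiltonian system, the function t ↦ Ĩ₃(t) = p₃(t) + (C₀·r(t)²/2)·sin²θ₁(t) has derivative zero at every t ∈ J, i.e. Ĩ₃ is a first integral. -/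
open Real

/-- Along every solution of the reduced Hamiltonian system, the function
`Ĩ₃(t) = p₃(t) + (C₀·r(t)²/2)·sin²θ₁(t)` has derivative zero at every `t ∈ J`,
i.e. `Ĩ₃` is a first integral. -/
theorem I3_is_first_integral
    (C₀ : ℝ) (hC₀ : C₀ ≠ 0) (J : Set ℝ) (hJopen : IsOpen J) (hJconn : J.OrdConnected)
    (r θ₁ θ₂ θ₃ p_r p₁ p₂ p₃ : ℝ → ℝ)
    (hr_pos : ∀ t ∈ J, 0 < r t)
    (hθ₁_range : ∀ t ∈ J, 0 < θ₁ t ∧ θ₁ t < Real.pi / 2)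
    (hr' : ∀ t ∈ J, HasDerivAt r (p_r t) t)
    (hθ₁' : ∀ t ∈ J, HasDerivAt θ₁ (p₁ t / (r t) ^ 2) t)
    (hθ₂' : ∀ t ∈ J, HasDerivAt θ₂
      (p₂ t / ((r t) ^ 2 * Real.cos (θ₁ t) ^ 2) - (p₂ t + p₃ t) / (1 + (r t) ^ 2)) t)
    (hθ₃' : ∀ t ∈ J, HasDerivAt θ₃
      (p₃ t / ((r t) ^ 2 * Real.sin (θ₁ t) ^ 2) - (p₂ t + p₃ t) / (1 + (r t) ^ 2)) t)
    (hp_r' : ∀ t ∈ J, HasDerivAt p_r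
      ((p₁ t) ^ 2 / (r t) ^ 3
        + ((p₂ t) ^ 2 / Real.cos (θ₁ t) ^ 2 + (p₃ t) ^ 2 / Real.sin (θ₁ t) ^ 2) / (r t) ^ 3
        - r t * (p₂ t + p₃ t) ^ 2 / (1 + (r t) ^ 2) ^ 2
        + C₀ * (p₂ t + p₃ t) / (r t * (1 + (r t) ^ 2))) t)
    (hp₁' : ∀ t ∈ J, HasDerivAt p₁
      ((1 / (r t) ^ 2) *
        (p₃ t * ((r t) ^ 2 * C₀ + p₃ t / Real.sin (θ₁ t) ^ 2) * Real.cot (θ₁ t)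
          - p₂ t * ((r t) ^ 2 * C₀ + p₂ t / Real.cos (θ₁ t) ^ 2) * Real.tan (θ₁ t))) t)
    (hp₂' : ∀ t ∈ J, HasDerivAt p₂
      (-C₀ * Real.cos (θ₁ t) * (r t * p_r t * Real.cos (θ₁ t) - p₁ t * Real.sin (θ₁ t))) t)
    (hp₃' : ∀ t ∈ J, HasDerivAt p₃
      (-C₀ * Real.sin (θ₁ t) * (r t * p_r t * Real.sin (θ₁ t) + p₁ t * Real.cos (θ₁ t))) t) :
    ∀ t ∈ J, HasDerivAt (fun s => p₃ s + C₀ * (r s) ^ 2 / 2 * Real.sin (θ₁ s) ^ 2) 0 t := by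
  intro t ht
  have hr : r t ≠ 0 := (hr_pos t ht).ne'
  have h := (hp₃' t ht).add
    (((((hr' t ht).pow 2).const_mul C₀).div_const 2).mul ((hθ₁' t ht).sin.pow 2))
  refine h.congr_deriv ?_
  simp only [Pi.pow_apply]
  field_simp
  ring
end

section
/- Along every solution of the reduced Hamiltonian system, the function t ↦ Ĩ₁(t) = p₁(t)² + p₂(t)²/cos²θ₁(t) + p₃(t)²/sin²θ₁(t) − (p₂(t)+p₃(t))² has derivative zero at every t ∈ J, i.e. Ĩ₁ is a first integral. -/
open Real

/-- Along every solution of the reduced Hamiltonian system, the function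
`Ĩ₁(t) = p₁(t)² + p₂(t)²/cos²θ₁(t) + p₃(t)²/sin²θ₁(t) − (p₂(t)+p₃(t))²` has derivative
zero at every `t ∈ J`, i.e. `Ĩ₁` is a first integral. -/
theorem I1_is_first_integral
    (C₀ : ℝ) (hC₀ : C₀ ≠ 0) (J : Set ℝ) (hJopen : IsOpen J) (hJconn : J.OrdConnected)
    (r θ₁ θ₂ θ₃ p_r p₁ p₂ p₃ : ℝ → ℝ)
    (hr_pos : ∀ t ∈ J, 0 < r t)
    (hθ₁_range : ∀ t ∈ J, 0 < θ₁ t ∧ θ₁ t < Real.pi / 2)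
    (hr' : ∀ t ∈ J, HasDerivAt r (p_r t) t)
    (hθ₁' : ∀ t ∈ J, HasDerivAt θ₁ (p₁ t / (r t) ^ 2) t)
    (hθ₂' : ∀ t ∈ J, HasDerivAt θ₂
      (p₂ t / ((r t) ^ 2 * Real.cos (θ₁ t) ^ 2) - (p₂ t + p₃ t) / (1 + (r t) ^ 2)) t)
    (hθ₃' : ∀ t ∈ J, HasDerivAt θ₃
      (p₃ t / ((r t) ^ 2 * Real.sin (θ₁ t) ^ 2) - (p₂ t + p₃ t) / (1 + (r t) ^ 2)) t)
    (hp_r' : ∀ t ∈ J, HasDerivAt p_r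
      ((p₁ t) ^ 2 / (r t) ^ 3
        + ((p₂ t) ^ 2 / Real.cos (θ₁ t) ^ 2 + (p₃ t) ^ 2 / Real.sin (θ₁ t) ^ 2) / (r t) ^ 3
        - r t * (p₂ t + p₃ t) ^ 2 / (1 + (r t) ^ 2) ^ 2
        + C₀ * (p₂ t + p₃ t) / (r t * (1 + (r t) ^ 2))) t)
    (hp₁' : ∀ t ∈ J, HasDerivAt p₁
      ((1 / (r t) ^ 2) *
        (p₃ t * ((r t) ^ 2 * C₀ + p₃ t / Real.sin (θ₁ t) ^ 2) * Real.cot (θ₁ t)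
          - p₂ t * ((r t) ^ 2 * C₀ + p₂ t / Real.cos (θ₁ t) ^ 2) * Real.tan (θ₁ t))) t)
    (hp₂' : ∀ t ∈ J, HasDerivAt p₂
      (-C₀ * Real.cos (θ₁ t) * (r t * p_r t * Real.cos (θ₁ t) - p₁ t * Real.sin (θ₁ t))) t)
    (hp₃' : ∀ t ∈ J, HasDerivAt p₃
      (-C₀ * Real.sin (θ₁ t) * (r t * p_r t * Real.sin (θ₁ t) + p₁ t * Real.cos (θ₁ t))) t) :
    ∀ t ∈ J, HasDerivAt (fun s =>
      (p₁ s) ^ 2 + (p₂ s) ^ 2 / Real.cos (θ₁ s) ^ 2 + (p₃ s) ^ 2 / Real.sin (θ₁ s) ^ 2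
        - (p₂ s + p₃ s) ^ 2) 0 t := by
  intro t ht
  obtain ⟨hθ_pos, hθ_lt⟩ := hθ₁_range t ht
  have hs : sin (θ₁ t) ≠ 0 := (sin_pos_of_pos_of_lt_pi hθ_pos (by linarith [pi_pos])).ne'
  have hc : cos (θ₁ t) ≠ 0 := (cos_pos_of_mem_Ioo ⟨by linarith, hθ_lt⟩).ne'
  have hr : r t ≠ 0 := (hr_pos t ht).ne'
  have hcos := (hθ₁' t ht).cos
  have hsin := (hθ₁' t ht).sin
  have h₁ := hp₁' t ht
  have h₂ := hp₂' t ht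
  have h₃ := hp₃' t ht
  refine ((((h₁.fun_pow 2).fun_add ((h₂.fun_pow 2).fun_div (hcos.fun_pow 2)
    (pow_ne_zero 2 hc))).fun_add ((h₃.fun_pow 2).fun_div (hsin.fun_pow 2)
    (pow_ne_zero 2 hs))).fun_sub ((h₂.fun_add h₃).fun_pow 2)).congr_deriv ?_
  have hsq := sin_sq_add_cos_sq (θ₁ t)
  rw [cot_eq_cos_div_sin, tan_eq_sin_div_cos]
  generalize sin (θ₁ t) = s at *
  generalize cos (θ₁ t) = c at *
  trans 2 * C₀ * r t * p_r t * (p₂ t + p₃ t) * (s ^ 2 + c ^ 2 - 1)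
  · field_simp
    ring
  · rw [hsq]
    ring
end

section
/- Along every solution of the reduced Hamiltonian system, the energy function t ↦ Ĩ₄(t) = (1/2)·(p_r(t)² + p₁(t)²/r(t)² + (p₂(t)²/cos²θ₁(t) + p₃(t)²/sin²θ₁(t))/r(t)² − (p₂(t)+p₃(t))²/(1+r(t)²)) has derivative zero at every t ∈ J, i.e. the Hamiltonian is a first integral. -/
open Real

/-- Along every solution of the reduced Hamiltonian system, the energy function
`Ĩ₄ = (1/2)·(p_r² + p₁²/r² + (p₂²/cos²θ₁ + p₃²/sin²θ₁)/r² − (p₂+p₃)²/(1+r²))` has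
derivative zero at every `t ∈ J`, i.e. the Hamiltonian is a first integral. -/
theorem Hamiltonian_is_first_integral
    (C₀ : ℝ) (hC₀ : C₀ ≠ 0) (J : Set ℝ) (hJopen : IsOpen J) (hJconn : J.OrdConnected)
    (r θ₁ θ₂ θ₃ p_r p₁ p₂ p₃ : ℝ → ℝ)
    (hr_pos : ∀ t ∈ J, 0 < r t)
    (hθ₁_range : ∀ t ∈ J, 0 < θ₁ t ∧ θ₁ t < Real.pi / 2)
    (hr' : ∀ t ∈ J, HasDerivAt r (p_r t) t)
    (hθ₁' : ∀ t ∈ J, HasDerivAt θ₁ (p₁ t / (r t) ^ 2) t)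
    (hθ₂' : ∀ t ∈ J, HasDerivAt θ₂
      (p₂ t / ((r t) ^ 2 * Real.cos (θ₁ t) ^ 2) - (p₂ t + p₃ t) / (1 + (r t) ^ 2)) t)
    (hθ₃' : ∀ t ∈ J, HasDerivAt θ₃
      (p₃ t / ((r t) ^ 2 * Real.sin (θ₁ t) ^ 2) - (p₂ t + p₃ t) / (1 + (r t) ^ 2)) t)
    (hp_r' : ∀ t ∈ J, HasDerivAt p_r
      ((p₁ t) ^ 2 / (r t) ^ 3
        + ((p₂ t) ^ 2 / Real.cos (θ₁ t) ^ 2 + (p₃ t) ^ 2 / Real.sin (θ₁ t) ^ 2) / (r t) ^ 3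
        - r t * (p₂ t + p₃ t) ^ 2 / (1 + (r t) ^ 2) ^ 2
        + C₀ * (p₂ t + p₃ t) / (r t * (1 + (r t) ^ 2))) t)
    (hp₁' : ∀ t ∈ J, HasDerivAt p₁
      ((1 / (r t) ^ 2) *
        (p₃ t * ((r t) ^ 2 * C₀ + p₃ t / Real.sin (θ₁ t) ^ 2) * Real.cot (θ₁ t)
          - p₂ t * ((r t) ^ 2 * C₀ + p₂ t / Real.cos (θ₁ t) ^ 2) * Real.tan (θ₁ t))) t)
    (hp₂' : ∀ t ∈ J, HasDerivAt p₂
      (-C₀ * Real.cos (θ₁ t) * (r t * p_r t * Real.cos (θ₁ t) - p₁ t * Real.sin (θ₁ t))) t)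
    (hp₃' : ∀ t ∈ J, HasDerivAt p₃
      (-C₀ * Real.sin (θ₁ t) * (r t * p_r t * Real.sin (θ₁ t) + p₁ t * Real.cos (θ₁ t))) t) :
    ∀ t ∈ J, HasDerivAt (fun s =>
      (1 / 2) * ((p_r s) ^ 2 + (p₁ s) ^ 2 / (r s) ^ 2
        + ((p₂ s) ^ 2 / Real.cos (θ₁ s) ^ 2 + (p₃ s) ^ 2 / Real.sin (θ₁ s) ^ 2) / (r s) ^ 2
        - (p₂ s + p₃ s) ^ 2 / (1 + (r s) ^ 2))) 0 t := by
  intro t ht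
  have hr : r t ≠ 0 := (hr_pos t ht).ne'
  have hr1 : 1 + r t ^ 2 ≠ 0 := by positivity
  obtain ⟨hθ_pos, hθ_lt⟩ := hθ₁_range t ht
  have hs : sin (θ₁ t) ≠ 0 := (sin_pos_of_pos_of_lt_pi hθ_pos (by linarith [pi_pos])).ne'
  have hc : cos (θ₁ t) ≠ 0 := (cos_pos_of_mem_Ioo ⟨by linarith [pi_pos], hθ_lt⟩).ne'
  have hr_sq := (hr' t ht).fun_pow 2
  have hc_sq := (hθ₁' t ht).cos.fun_pow 2
  have hs_sq := (hθ₁' t ht).sin.fun_pow 2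
  have hangular := (((hp₂' t ht).fun_pow 2).fun_div hc_sq (pow_ne_zero 2 hc)).fun_add
    (((hp₃' t ht).fun_pow 2).fun_div hs_sq (pow_ne_zero 2 hs))
  have henergy := ((((((hp_r' t ht).fun_pow 2).fun_add
    (((hp₁' t ht).fun_pow 2).fun_div hr_sq (pow_ne_zero 2 hr))).fun_add
    (hangular.fun_div hr_sq (pow_ne_zero 2 hr))).fun_sub
    ((((hp₂' t ht).fun_add (hp₃' t ht)).fun_pow 2).fun_div (hr_sq.const_add 1) hr1)).const_mul
    (1 / 2))
  refine henergy.congr_deriv ?_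
  rw [cot_eq_cos_div_sin, tan_eq_sin_div_cos]
  have hsum : -C₀ * cos (θ₁ t) * (r t * p_r t * cos (θ₁ t) - p₁ t * sin (θ₁ t))
      + -C₀ * sin (θ₁ t) * (r t * p_r t * sin (θ₁ t) + p₁ t * cos (θ₁ t))
      = -C₀ * r t * p_r t := by
    linear_combination (-C₀ * r t * p_r t) * sin_sq_add_cos_sq (θ₁ t)
  rw [hsum]
  simp only [Nat.cast_ofNat, Nat.add_one_sub_one, pow_one]
  field_simp
  ring
end

section
/- Suppose a solution of the reduced Hamiltonian system satisfies, for all t ∈ J, Ĩ₁(t) = C₁, Ĩ₂(t) = C₂, Ĩ₃(t) = C₃ and Ĩ₄(t) = 1/2 for real constants C₁, C₂, C₃ (arc-length parameterisation). Then for all t ∈ J the radial coordinate satisfies the one-degree-of-freedom equation r'(t)²·r(t)²·(1+r(t)²) = A·r(t)⁴ + B·r(t)² + C, where A = 1 − C₀²/4, B = 1 − C₁ + (C₂+C₃)·C₀, and C = −C₁ − (C₂+C₃)². -/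
open Real

/-- On an arc-length parameterised solution (`Ĩ₄ = 1/2`) with first-integral values
`Ĩ₁ = C₁`, `Ĩ₂ = C₂`, `Ĩ₃ = C₃`, the radial coordinate satisfies the one-degree-of-freedom
equation `r'²·r²·(1+r²) = A·r⁴ + B·r² + C` with `A = 1 − C₀²/4`,
`B = 1 − C₁ + (C₂+C₃)·C₀` and `C = −C₁ − (C₂+C₃)²`. -/
theorem radial_equation
    (C₀ : ℝ) (hC₀ : C₀ ≠ 0) (J : Set ℝ) (hJopen : IsOpen J) (hJconn : J.OrdConnected)
    (r θ₁ θ₂ θ₃ p_r p₁ p₂ p₃ : ℝ → ℝ)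
    (hr_pos : ∀ t ∈ J, 0 < r t)
    (hθ₁_range : ∀ t ∈ J, 0 < θ₁ t ∧ θ₁ t < Real.pi / 2)
    (hr' : ∀ t ∈ J, HasDerivAt r (p_r t) t)
    (hθ₁' : ∀ t ∈ J, HasDerivAt θ₁ (p₁ t / (r t) ^ 2) t)
    (hθ₂' : ∀ t ∈ J, HasDerivAt θ₂
      (p₂ t / ((r t) ^ 2 * Real.cos (θ₁ t) ^ 2) - (p₂ t + p₃ t) / (1 + (r t) ^ 2)) t)
    (hθ₃' : ∀ t ∈ J, HasDerivAt θ₃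
      (p₃ t / ((r t) ^ 2 * Real.sin (θ₁ t) ^ 2) - (p₂ t + p₃ t) / (1 + (r t) ^ 2)) t)
    (hp_r' : ∀ t ∈ J, HasDerivAt p_r
      ((p₁ t) ^ 2 / (r t) ^ 3
        + ((p₂ t) ^ 2 / Real.cos (θ₁ t) ^ 2 + (p₃ t) ^ 2 / Real.sin (θ₁ t) ^ 2) / (r t) ^ 3
        - r t * (p₂ t + p₃ t) ^ 2 / (1 + (r t) ^ 2) ^ 2
        + C₀ * (p₂ t + p₃ t) / (r t * (1 + (r t) ^ 2))) t)
    (hp₁' : ∀ t ∈ J, HasDerivAt p₁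
      ((1 / (r t) ^ 2) *
        (p₃ t * ((r t) ^ 2 * C₀ + p₃ t / Real.sin (θ₁ t) ^ 2) * Real.cot (θ₁ t)
          - p₂ t * ((r t) ^ 2 * C₀ + p₂ t / Real.cos (θ₁ t) ^ 2) * Real.tan (θ₁ t))) t)
    (hp₂' : ∀ t ∈ J, HasDerivAt p₂
      (-C₀ * Real.cos (θ₁ t) * (r t * p_r t * Real.cos (θ₁ t) - p₁ t * Real.sin (θ₁ t))) t)
    (hp₃' : ∀ t ∈ J, HasDerivAt p₃
      (-C₀ * Real.sin (θ₁ t) * (r t * p_r t * Real.sin (θ₁ t) + p₁ t * Real.cos (θ₁ t))) t)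
    (C₁ C₂ C₃ : ℝ)
    (hI₁ : ∀ t ∈ J, (p₁ t) ^ 2 + (p₂ t) ^ 2 / Real.cos (θ₁ t) ^ 2
      + (p₃ t) ^ 2 / Real.sin (θ₁ t) ^ 2 - (p₂ t + p₃ t) ^ 2 = C₁)
    (hI₂ : ∀ t ∈ J, p₂ t + C₀ * (r t) ^ 2 / 2 * Real.cos (θ₁ t) ^ 2 = C₂)
    (hI₃ : ∀ t ∈ J, p₃ t + C₀ * (r t) ^ 2 / 2 * Real.sin (θ₁ t) ^ 2 = C₃)
    (hI₄ : ∀ t ∈ J, (1 / 2) * ((p_r t) ^ 2 + (p₁ t) ^ 2 / (r t) ^ 2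
      + ((p₂ t) ^ 2 / Real.cos (θ₁ t) ^ 2 + (p₃ t) ^ 2 / Real.sin (θ₁ t) ^ 2) / (r t) ^ 2
      - (p₂ t + p₃ t) ^ 2 / (1 + (r t) ^ 2)) = 1 / 2) :
    ∀ t ∈ J,
      (deriv r t) ^ 2 * (r t) ^ 2 * (1 + (r t) ^ 2) =
        (1 - C₀ ^ 2 / 4) * (r t) ^ 4 + (1 - C₁ + (C₂ + C₃) * C₀) * (r t) ^ 2
          + (-C₁ - (C₂ + C₃) ^ 2) := by
  intro t ht
  have hr := hr_pos t ht
  have hsum : p₂ t + p₃ t = C₂ + C₃ - C₀ * (r t) ^ 2 / 2 := by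
    linear_combination hI₂ t ht + hI₃ t ht
      - C₀ * (r t) ^ 2 / 2 * Real.sin_sq_add_cos_sq (θ₁ t)
  have hangular : (p₁ t) ^ 2 + ((p₂ t) ^ 2 / Real.cos (θ₁ t) ^ 2
      + (p₃ t) ^ 2 / Real.sin (θ₁ t) ^ 2) = C₁ + (p₂ t + p₃ t) ^ 2 := by
    linear_combination hI₁ t ht
  have henergy : (p_r t) ^ 2 + (C₁ + (p₂ t + p₃ t) ^ 2) / (r t) ^ 2
      - (p₂ t + p₃ t) ^ 2 / (1 + (r t) ^ 2) = 1 := by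
    rw [← hangular, add_div]
    linear_combination 2 * hI₄ t ht
  rw [hsum] at henergy
  rw [(hr' t ht).deriv]
  have hpos : 1 + (r t) ^ 2 ≠ 0 := by positivity
  field_simp at henergy
  linear_combination henergy / 4
end

section
/- Suppose a solution of the reduced Hamiltonian system satisfies, for all t ∈ J, Ĩ₁(t) = C₁, Ĩ₂(t) = C₂ and Ĩ₃(t) = C₃ for real constants C₁, C₂, C₃. Then for all t ∈ J the angle θ₁ satisfies r(t)⁴·θ₁'(t)² = C₁ + (C₂+C₃)² − C₂²/cos²θ₁(t) − C₃²/sin²θ₁(t). -/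
open Real

/-- On a solution with first-integral values `Ĩ₁ = C₁`, `Ĩ₂ = C₂`, `Ĩ₃ = C₃`, the angle
`θ₁` satisfies `r⁴·θ₁'² = C₁ + (C₂+C₃)² − C₂²/cos²θ₁ − C₃²/sin²θ₁`. -/
theorem theta1_equation
    (C₀ : ℝ) (hC₀ : C₀ ≠ 0) (J : Set ℝ) (hJopen : IsOpen J) (hJconn : J.OrdConnected)
    (r θ₁ θ₂ θ₃ p_r p₁ p₂ p₃ : ℝ → ℝ)
    (hr_pos : ∀ t ∈ J, 0 < r t)
    (hθ₁_range : ∀ t ∈ J, 0 < θ₁ t ∧ θ₁ t < Real.pi / 2)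
    (hr' : ∀ t ∈ J, HasDerivAt r (p_r t) t)
    (hθ₁' : ∀ t ∈ J, HasDerivAt θ₁ (p₁ t / (r t) ^ 2) t)
    (hθ₂' : ∀ t ∈ J, HasDerivAt θ₂
      (p₂ t / ((r t) ^ 2 * Real.cos (θ₁ t) ^ 2) - (p₂ t + p₃ t) / (1 + (r t) ^ 2)) t)
    (hθ₃' : ∀ t ∈ J, HasDerivAt θ₃
      (p₃ t / ((r t) ^ 2 * Real.sin (θ₁ t) ^ 2) - (p₂ t + p₃ t) / (1 + (r t) ^ 2)) t)
    (hp_r' : ∀ t ∈ J, HasDerivAt p_r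
      ((p₁ t) ^ 2 / (r t) ^ 3
        + ((p₂ t) ^ 2 / Real.cos (θ₁ t) ^ 2 + (p₃ t) ^ 2 / Real.sin (θ₁ t) ^ 2) / (r t) ^ 3
        - r t * (p₂ t + p₃ t) ^ 2 / (1 + (r t) ^ 2) ^ 2
        + C₀ * (p₂ t + p₃ t) / (r t * (1 + (r t) ^ 2))) t)
    (hp₁' : ∀ t ∈ J, HasDerivAt p₁
      ((1 / (r t) ^ 2) *
        (p₃ t * ((r t) ^ 2 * C₀ + p₃ t / Real.sin (θ₁ t) ^ 2) * Real.cot (θ₁ t)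
          - p₂ t * ((r t) ^ 2 * C₀ + p₂ t / Real.cos (θ₁ t) ^ 2) * Real.tan (θ₁ t))) t)
    (hp₂' : ∀ t ∈ J, HasDerivAt p₂
      (-C₀ * Real.cos (θ₁ t) * (r t * p_r t * Real.cos (θ₁ t) - p₁ t * Real.sin (θ₁ t))) t)
    (hp₃' : ∀ t ∈ J, HasDerivAt p₃
      (-C₀ * Real.sin (θ₁ t) * (r t * p_r t * Real.sin (θ₁ t) + p₁ t * Real.cos (θ₁ t))) t)
    (C₁ C₂ C₃ : ℝ)
    (hI₁ : ∀ t ∈ J, (p₁ t) ^ 2 + (p₂ t) ^ 2 / Real.cos (θ₁ t) ^ 2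
      + (p₃ t) ^ 2 / Real.sin (θ₁ t) ^ 2 - (p₂ t + p₃ t) ^ 2 = C₁)
    (hI₂ : ∀ t ∈ J, p₂ t + C₀ * (r t) ^ 2 / 2 * Real.cos (θ₁ t) ^ 2 = C₂)
    (hI₃ : ∀ t ∈ J, p₃ t + C₀ * (r t) ^ 2 / 2 * Real.sin (θ₁ t) ^ 2 = C₃) :
    ∀ t ∈ J,
      (r t) ^ 4 * (deriv θ₁ t) ^ 2 =
        C₁ + (C₂ + C₃) ^ 2 - C₂ ^ 2 / Real.cos (θ₁ t) ^ 2 - C₃ ^ 2 / Real.sin (θ₁ t) ^ 2 := by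
  intro t ht
  have hr : r t ≠ 0 := (hr_pos t ht).ne'
  obtain ⟨hpos, hlt⟩ := hθ₁_range t ht
  have hc : Real.cos (θ₁ t) ≠ 0 :=
    (Real.cos_pos_of_mem_Ioo ⟨by linarith [Real.pi_pos], hlt⟩).ne'
  have hs : Real.sin (θ₁ t) ≠ 0 :=
    (Real.sin_pos_of_pos_of_lt_pi hpos (by linarith [Real.pi_pos])).ne'
  have hcs := Real.sin_sq_add_cos_sq (θ₁ t)
  have hderiv : r t ^ 4 * deriv θ₁ t ^ 2 = p₁ t ^ 2 := by
    rw [(hθ₁' t ht).deriv]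
    field_simp
  rw [hderiv, ← hI₁ t ht, ← hI₂ t ht, ← hI₃ t ht]
  generalize C₀ * r t ^ 2 / 2 = K
  have h₂ : (p₂ t + K * Real.cos (θ₁ t) ^ 2) ^ 2 / Real.cos (θ₁ t) ^ 2
      = p₂ t ^ 2 / Real.cos (θ₁ t) ^ 2 + 2 * K * p₂ t + K ^ 2 * Real.cos (θ₁ t) ^ 2 := by
    field_simp
    ring
  have h₃ : (p₃ t + K * Real.sin (θ₁ t) ^ 2) ^ 2 / Real.sin (θ₁ t) ^ 2
      = p₃ t ^ 2 / Real.sin (θ₁ t) ^ 2 + 2 * K * p₃ t + K ^ 2 * Real.sin (θ₁ t) ^ 2 := by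
    field_simp
    ring
  have hsum : p₂ t + K * Real.cos (θ₁ t) ^ 2 + (p₃ t + K * Real.sin (θ₁ t) ^ 2)
      = p₂ t + p₃ t + K := by
    linear_combination K * hcs
  rw [h₂, h₃, hsum]
  linear_combination K ^ 2 * hcs
end

section
/- Suppose a solution of the reduced Hamiltonian system satisfies, for all t ∈ J, Ĩ₁(t) = C₁, Ĩ₂(t) = C₂, Ĩ₃(t) = C₃ and Ĩ₄(t) = 1/2, and set A = 1 − C₀²/4, B = 1 − C₁ + (C₂+C₃)·C₀, C = −C₁ − (C₂+C₃)². If A > 0 and C < 0, and α > 0 is the unique positive root of f(r) = A·r⁴ + B·r² + C, then r(t) ≥ α for all t ∈ J; that is, the trajectory lies outside the hypersphere r = α (trajectories of the first type). -/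
open Real

/-- A quadratic `a s² + b s + c` with `a > 0 > c` is negative on `(0, x)` for a root `x`. -/
theorem root_le_of_quadratic_nonneg {a b c x s : ℝ} (ha : 0 < a) (hc : c < 0) (hx : 0 < x)
    (hs : 0 < s) (hroot : a * x ^ 2 + b * x + c = 0) (hnonneg : 0 ≤ a * s ^ 2 + b * s + c) :
    x ≤ s := by
  by_contra! hlt
  have hfactor : x * (a * s ^ 2 + b * s + c) = (s - x) * (a * x * s - c) := by
    linear_combination s * hroot
  have hpos : 0 < a * x * s - c := by nlinarith [mul_pos (mul_pos ha hx) hs]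
  nlinarith [mul_nonneg hx.le hnonneg, mul_pos (sub_pos.2 hlt) hpos]

/-- Trajectories of the first type: if `A = 1 − C₀²/4 > 0`, `C = −C₁ − (C₂+C₃)² < 0`, and
`α > 0` is the (unique) positive root of `f(r) = A·r⁴ + B·r² + C`, then an arc-length
parameterised solution with first-integral values `C₁, C₂, C₃` satisfies `r(t) ≥ α` for all
`t ∈ J`: the trajectory lies outside the hypersphere `r = α`. -/
theorem trajectory_first_type
    (C₀ : ℝ) (hC₀ : C₀ ≠ 0) (J : Set ℝ) (hJopen : IsOpen J) (hJconn : J.OrdConnected)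
    (r θ₁ θ₂ θ₃ p_r p₁ p₂ p₃ : ℝ → ℝ)
    (hr_pos : ∀ t ∈ J, 0 < r t)
    (hθ₁_range : ∀ t ∈ J, 0 < θ₁ t ∧ θ₁ t < Real.pi / 2)
    (hr' : ∀ t ∈ J, HasDerivAt r (p_r t) t)
    (hθ₁' : ∀ t ∈ J, HasDerivAt θ₁ (p₁ t / (r t) ^ 2) t)
    (hθ₂' : ∀ t ∈ J, HasDerivAt θ₂
      (p₂ t / ((r t) ^ 2 * Real.cos (θ₁ t) ^ 2) - (p₂ t + p₃ t) / (1 + (r t) ^ 2)) t)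
    (hθ₃' : ∀ t ∈ J, HasDerivAt θ₃
      (p₃ t / ((r t) ^ 2 * Real.sin (θ₁ t) ^ 2) - (p₂ t + p₃ t) / (1 + (r t) ^ 2)) t)
    (hp_r' : ∀ t ∈ J, HasDerivAt p_r
      ((p₁ t) ^ 2 / (r t) ^ 3
        + ((p₂ t) ^ 2 / Real.cos (θ₁ t) ^ 2 + (p₃ t) ^ 2 / Real.sin (θ₁ t) ^ 2) / (r t) ^ 3
        - r t * (p₂ t + p₃ t) ^ 2 / (1 + (r t) ^ 2) ^ 2
        + C₀ * (p₂ t + p₃ t) / (r t * (1 + (r t) ^ 2))) t)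
    (hp₁' : ∀ t ∈ J, HasDerivAt p₁
      ((1 / (r t) ^ 2) *
        (p₃ t * ((r t) ^ 2 * C₀ + p₃ t / Real.sin (θ₁ t) ^ 2) * Real.cot (θ₁ t)
          - p₂ t * ((r t) ^ 2 * C₀ + p₂ t / Real.cos (θ₁ t) ^ 2) * Real.tan (θ₁ t))) t)
    (hp₂' : ∀ t ∈ J, HasDerivAt p₂
      (-C₀ * Real.cos (θ₁ t) * (r t * p_r t * Real.cos (θ₁ t) - p₁ t * Real.sin (θ₁ t))) t)
    (hp₃' : ∀ t ∈ J, HasDerivAt p₃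
      (-C₀ * Real.sin (θ₁ t) * (r t * p_r t * Real.sin (θ₁ t) + p₁ t * Real.cos (θ₁ t))) t)
    (C₁ C₂ C₃ : ℝ)
    (hI₁ : ∀ t ∈ J, (p₁ t) ^ 2 + (p₂ t) ^ 2 / Real.cos (θ₁ t) ^ 2
      + (p₃ t) ^ 2 / Real.sin (θ₁ t) ^ 2 - (p₂ t + p₃ t) ^ 2 = C₁)
    (hI₂ : ∀ t ∈ J, p₂ t + C₀ * (r t) ^ 2 / 2 * Real.cos (θ₁ t) ^ 2 = C₂)
    (hI₃ : ∀ t ∈ J, p₃ t + C₀ * (r t) ^ 2 / 2 * Real.sin (θ₁ t) ^ 2 = C₃)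
    (hI₄ : ∀ t ∈ J, (1 / 2) * ((p_r t) ^ 2 + (p₁ t) ^ 2 / (r t) ^ 2
      + ((p₂ t) ^ 2 / Real.cos (θ₁ t) ^ 2 + (p₃ t) ^ 2 / Real.sin (θ₁ t) ^ 2) / (r t) ^ 2
      - (p₂ t + p₃ t) ^ 2 / (1 + (r t) ^ 2)) = 1 / 2)
    (hA : 0 < 1 - C₀ ^ 2 / 4)
    (hC : -C₁ - (C₂ + C₃) ^ 2 < 0)
    (α : ℝ) (hα : 0 < α)
    (hαroot : (1 - C₀ ^ 2 / 4) * α ^ 4 + (1 - C₁ + (C₂ + C₃) * C₀) * α ^ 2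
      + (-C₁ - (C₂ + C₃) ^ 2) = 0) :
    ∀ t ∈ J, α ≤ r t := by
  intro t ht
  have hr := hr_pos t ht
  have h₁ := hI₁ t ht
  have h₄ := hI₄ t ht
  have hsum : p₂ t + p₃ t = C₂ + C₃ - C₀ * r t ^ 2 / 2 := by
    linear_combination hI₂ t ht + hI₃ t ht
      - C₀ * r t ^ 2 / 2 * Real.sin_sq_add_cos_sq (θ₁ t)
  rw [hsum] at h₁ h₄
  generalize p₂ t ^ 2 / Real.cos (θ₁ t) ^ 2 = u at h₁ h₄
  generalize p₃ t ^ 2 / Real.sin (θ₁ t) ^ 2 = v at h₁ h₄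
  have hradial : p_r t ^ 2 * (r t ^ 2 * (1 + r t ^ 2)) =
      (1 - C₀ ^ 2 / 4) * (r t ^ 2) ^ 2 + (1 - C₁ + (C₂ + C₃) * C₀) * r t ^ 2
        + (-C₁ - (C₂ + C₃) ^ 2) := by
    have hden : 1 + r t ^ 2 ≠ 0 := by positivity
    field_simp at h₄
    linear_combination h₄ / 4 - (1 + r t ^ 2) * h₁
  have hsq : α ^ 2 ≤ r t ^ 2 :=
    root_le_of_quadratic_nonneg (b := 1 - C₁ + (C₂ + C₃) * C₀) hA hC (by positivity)
      (by positivity) (by linear_combination hαroot) (by rw [← hradial]; positivity)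
  exact (sq_le_sq₀ hα.le hr.le).1 hsq
end

section
/- Suppose a solution of the reduced Hamiltonian system satisfies, for all t ∈ J, Ĩ₁(t) = C₁, Ĩ₂(t) = C₂, Ĩ₃(t) = C₃ and Ĩ₄(t) = 1/2, and set A = 1 − C₀²/4, B = 1 − C₁ + (C₂+C₃)·C₀, C = −C₁ − (C₂+C₃)². If A < 0 and the quadratic A·s² + B·s + C has two distinct positive real roots s₁ < s₂, then √s₁ ≤ r(t) ≤ √s₂ for all t ∈ J; that is, the trajectory lies between the hyperspheres r = √s₁ and r = √s₂ (trajectories of the second type). -/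
open Real

/-- A quadratic with negative leading coefficient and two roots `s₁ < s₂` is nonnegative only on
`[s₁, s₂]`. -/
lemma mem_Icc_of_quadratic_nonneg {a b c s₁ s₂ s : ℝ} (ha : a < 0) (h₁₂ : s₁ < s₂)
    (h₁ : a * s₁ ^ 2 + b * s₁ + c = 0) (h₂ : a * s₂ ^ 2 + b * s₂ + c = 0)
    (hs : 0 ≤ a * s ^ 2 + b * s + c) : s₁ ≤ s ∧ s ≤ s₂ := by
  have hb : b = -a * (s₁ + s₂) := by
    have h : (s₂ - s₁) * (b + a * (s₁ + s₂)) = 0 := by linear_combination h₂ - h₁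
    linarith [(mul_eq_zero.mp h).resolve_left (sub_pos.mpr h₁₂).ne']
  have hfac : a * s ^ 2 + b * s + c = a * ((s - s₁) * (s - s₂)) := by
    linear_combination h₁ + (s - s₁) * hb
  have hprod : (s - s₁) * (s - s₂) ≤ 0 := nonpos_of_mul_nonneg_right (hfac ▸ hs) ha
  constructor <;> by_contra! h
  · linarith [mul_pos_of_neg_of_neg (sub_neg.mpr h) (sub_neg.mpr (h.trans h₁₂))]
  · linarith [mul_pos (sub_pos.mpr (h₁₂.trans h)) (sub_pos.mpr h)]

/-- Trajectories of the second type: if `A = 1 − C₀²/4 < 0` and the quadratic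
`A·s² + B·s + C` has two distinct positive real roots `s₁ < s₂`, then an arc-length
parameterised solution with first-integral values `C₁, C₂, C₃` satisfies
`√s₁ ≤ r(t) ≤ √s₂` for all `t ∈ J`: the trajectory lies between the hyperspheres
`r = √s₁` and `r = √s₂`. -/
theorem trajectory_second_type
    (C₀ : ℝ) (hC₀ : C₀ ≠ 0) (J : Set ℝ) (hJopen : IsOpen J) (hJconn : J.OrdConnected)
    (r θ₁ θ₂ θ₃ p_r p₁ p₂ p₃ : ℝ → ℝ)
    (hr_pos : ∀ t ∈ J, 0 < r t)
    (hθ₁_range : ∀ t ∈ J, 0 < θ₁ t ∧ θ₁ t < Real.pi / 2)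
    (hr' : ∀ t ∈ J, HasDerivAt r (p_r t) t)
    (hθ₁' : ∀ t ∈ J, HasDerivAt θ₁ (p₁ t / (r t) ^ 2) t)
    (hθ₂' : ∀ t ∈ J, HasDerivAt θ₂
      (p₂ t / ((r t) ^ 2 * Real.cos (θ₁ t) ^ 2) - (p₂ t + p₃ t) / (1 + (r t) ^ 2)) t)
    (hθ₃' : ∀ t ∈ J, HasDerivAt θ₃
      (p₃ t / ((r t) ^ 2 * Real.sin (θ₁ t) ^ 2) - (p₂ t + p₃ t) / (1 + (r t) ^ 2)) t)
    (hp_r' : ∀ t ∈ J, HasDerivAt p_r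
      ((p₁ t) ^ 2 / (r t) ^ 3
        + ((p₂ t) ^ 2 / Real.cos (θ₁ t) ^ 2 + (p₃ t) ^ 2 / Real.sin (θ₁ t) ^ 2) / (r t) ^ 3
        - r t * (p₂ t + p₃ t) ^ 2 / (1 + (r t) ^ 2) ^ 2
        + C₀ * (p₂ t + p₃ t) / (r t * (1 + (r t) ^ 2))) t)
    (hp₁' : ∀ t ∈ J, HasDerivAt p₁
      ((1 / (r t) ^ 2) *
        (p₃ t * ((r t) ^ 2 * C₀ + p₃ t / Real.sin (θ₁ t) ^ 2) * Real.cot (θ₁ t)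
          - p₂ t * ((r t) ^ 2 * C₀ + p₂ t / Real.cos (θ₁ t) ^ 2) * Real.tan (θ₁ t))) t)
    (hp₂' : ∀ t ∈ J, HasDerivAt p₂
      (-C₀ * Real.cos (θ₁ t) * (r t * p_r t * Real.cos (θ₁ t) - p₁ t * Real.sin (θ₁ t))) t)
    (hp₃' : ∀ t ∈ J, HasDerivAt p₃
      (-C₀ * Real.sin (θ₁ t) * (r t * p_r t * Real.sin (θ₁ t) + p₁ t * Real.cos (θ₁ t))) t)
    (C₁ C₂ C₃ : ℝ)
    (hI₁ : ∀ t ∈ J, (p₁ t) ^ 2 + (p₂ t) ^ 2 / Real.cos (θ₁ t) ^ 2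
      + (p₃ t) ^ 2 / Real.sin (θ₁ t) ^ 2 - (p₂ t + p₃ t) ^ 2 = C₁)
    (hI₂ : ∀ t ∈ J, p₂ t + C₀ * (r t) ^ 2 / 2 * Real.cos (θ₁ t) ^ 2 = C₂)
    (hI₃ : ∀ t ∈ J, p₃ t + C₀ * (r t) ^ 2 / 2 * Real.sin (θ₁ t) ^ 2 = C₃)
    (hI₄ : ∀ t ∈ J, (1 / 2) * ((p_r t) ^ 2 + (p₁ t) ^ 2 / (r t) ^ 2
      + ((p₂ t) ^ 2 / Real.cos (θ₁ t) ^ 2 + (p₃ t) ^ 2 / Real.sin (θ₁ t) ^ 2) / (r t) ^ 2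
      - (p₂ t + p₃ t) ^ 2 / (1 + (r t) ^ 2)) = 1 / 2)
    (hA : 1 - C₀ ^ 2 / 4 < 0)
    (s₁ s₂ : ℝ) (hs₁ : 0 < s₁) (hs₁₂ : s₁ < s₂)
    (hroot₁ : (1 - C₀ ^ 2 / 4) * s₁ ^ 2 + (1 - C₁ + (C₂ + C₃) * C₀) * s₁
      + (-C₁ - (C₂ + C₃) ^ 2) = 0)
    (hroot₂ : (1 - C₀ ^ 2 / 4) * s₂ ^ 2 + (1 - C₁ + (C₂ + C₃) * C₀) * s₂
      + (-C₁ - (C₂ + C₃) ^ 2) = 0) :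
    ∀ t ∈ J, Real.sqrt s₁ ≤ r t ∧ r t ≤ Real.sqrt s₂ := by
  intro t ht
  have hr := hr_pos t ht
  have h₁ := hI₁ t ht
  have h₄ := hI₄ t ht
  have hP : p₂ t + p₃ t = C₂ + C₃ - C₀ * r t ^ 2 / 2 := by
    linear_combination hI₂ t ht + hI₃ t ht
      - C₀ * r t ^ 2 / 2 * Real.sin_sq_add_cos_sq (θ₁ t)
  rw [hP] at h₁ h₄
  have hquad : (1 - C₀ ^ 2 / 4) * (r t ^ 2) ^ 2 + (1 - C₁ + (C₂ + C₃) * C₀) * r t ^ 2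
      + (-C₁ - (C₂ + C₃) ^ 2) = r t ^ 2 * (1 + r t ^ 2) * p_r t ^ 2 := by
    generalize p₂ t ^ 2 / Real.cos (θ₁ t) ^ 2 = x at h₁ h₄
    generalize p₃ t ^ 2 / Real.sin (θ₁ t) ^ 2 = y at h₁ h₄
    field_simp at h₄
    linear_combination (1 + r t ^ 2) * h₁ - h₄ / 4
  obtain ⟨hlo, hhi⟩ := mem_Icc_of_quadratic_nonneg hA hs₁₂ hroot₁ hroot₂
    (hquad ▸ by positivity : 0 ≤ (1 - C₀ ^ 2 / 4) * (r t ^ 2) ^ 2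
      + (1 - C₁ + (C₂ + C₃) * C₀) * r t ^ 2 + (-C₁ - (C₂ + C₃) ^ 2))
  exact ⟨Real.sqrt_le_iff.mpr ⟨hr.le, hlo⟩, Real.le_sqrt_of_sq_le hhi⟩
end

section
/- Let B > 0 and C ≤ 0 be real numbers and set a = −C/B ≥ 0. Then for every r with r² > a and r > 0, the function T(r) = (1/(2√B))·(√((1+r²)·(r²−a)) + (1+a)·log(√(1+r²) + √(r²−a)) − ((1+a)/2)·log(1+a)) has derivative T'(r) = r·√(1+r²)/√(B·r² + C). In particular T is an explicit antiderivative realizing the time–radius relation t(r) in the case A = 0 of the radial equation. -/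
open Real

theorem hasDerivAt_sqrt_mul_add_log {a r : ℝ} (h : a < r ^ 2) :
    HasDerivAt (fun x : ℝ => √((1 + x ^ 2) * (x ^ 2 - a))
      + (1 + a) * Real.log (√(1 + x ^ 2) + √(x ^ 2 - a)))
      (2 * r * √(1 + r ^ 2) / √(r ^ 2 - a)) r := by
  have hp : 0 < 1 + r ^ 2 := by positivity
  have hq : 0 < r ^ 2 - a := sub_pos.2 h
  have hP := Real.sqrt_pos.2 hp
  have hQ := Real.sqrt_pos.2 hq
  have hsq : HasDerivAt (fun x : ℝ => x ^ 2) (2 * r) r := by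
    simpa using hasDerivAt_pow 2 r
  have dp := hsq.const_add 1
  have dq := hsq.sub_const a
  have hd := ((dp.mul dq).sqrt (mul_pos hp hq).ne').add
    ((((dp.sqrt hp.ne').add (dq.sqrt hq.ne')).log (add_pos hP hQ).ne').const_mul (1 + a))
  refine hd.congr_deriv ?_
  have hP2 := Real.sq_sqrt hp.le
  have hQ2 := Real.sq_sqrt hq.le
  simp only [Pi.mul_apply, Pi.add_apply]
  rw [Real.sqrt_mul hp.le]
  generalize √(1 + r ^ 2) = P at *
  generalize √(r ^ 2 - a) = Q at *
  have ha : 1 + a = P ^ 2 - Q ^ 2 := by linarith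
  rw [ha, ← hP2, ← hQ2]
  have hPQ : P + Q ≠ 0 := (add_pos hP hQ).ne'
  field_simp
  ring

/-- In the case `A = 0`, with `B > 0`, `C ≤ 0` and `a = −C/B`, the explicit function
`T(r) = (1/(2√B))·(√((1+r²)(r²−a)) + (1+a)·log(√(1+r²) + √(r²−a)) − ((1+a)/2)·log(1+a))`
satisfies `T'(r) = r·√(1+r²)/√(B·r² + C)` for every `r > 0` with `r² > a`: it is an explicit
antiderivative realizing the time–radius relation `t(r)`. -/
theorem antiderivative_case_A_zero (B C : ℝ) (hB : 0 < B) (hC : C ≤ 0) :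
    ∀ r : ℝ, 0 < r → -C / B < r ^ 2 →
      HasDerivAt (fun x : ℝ =>
        (1 / (2 * Real.sqrt B)) *
          (Real.sqrt ((1 + x ^ 2) * (x ^ 2 - (-C / B)))
            + (1 + (-C / B)) * Real.log (Real.sqrt (1 + x ^ 2) + Real.sqrt (x ^ 2 - (-C / B)))
            - ((1 + (-C / B)) / 2) * Real.log (1 + (-C / B))))
        (r * Real.sqrt (1 + r ^ 2) / Real.sqrt (B * r ^ 2 + C)) r := by
  intro r _ h
  have hd := ((hasDerivAt_sqrt_mul_add_log h).sub_const
    ((1 + -C / B) / 2 * Real.log (1 + -C / B))).const_mul (1 / (2 * √B))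
  refine hd.congr_deriv ?_
  have hfac : B * r ^ 2 + C = B * (r ^ 2 - -C / B) := by
    field_simp
    ring
  have hQ := Real.sqrt_pos.2 (sub_pos.2 h)
  have hB' := Real.sqrt_pos.2 hB
  rw [hfac, Real.sqrt_mul hB.le]
  field_simp
end

section
/- On the open set U = {(r, θ₁, θ₂, θ₃, p_r, p₁, p₂, p₃) ∈ ℝ⁸ : r > 0, 0 < θ₁ < π/2}, the four first integrals Ĩ₁ = p₁² + p₂²/cos²θ₁ + p₃²/sin²θ₁ − (p₂+p₃)², Ĩ₂ = p₂ + (C₀·r²/2)·cos²θ₁, Ĩ₃ = p₃ + (C₀·r²/2)·sin²θ₁, and Ĩ₄ = (1/2)·(p_r² + p₁²/r² + (p₂²/cos²θ₁ + p₃²/sin²θ₁)/r² − (p₂+p₃)²/(1+r²)) are pairwise in involution: {Ĩ_i, Ĩ_j} = 0 at every point of U for all i, j ∈ {1,2,3,4}. -/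
open Real

/-- An observable: a differentiable function of the eight variables
`(r, θ₁, θ₂, θ₃, p_r, p₁, p₂, p₃)`. -/
abbrev HeisObs := ℝ → ℝ → ℝ → ℝ → ℝ → ℝ → ℝ → ℝ → ℝ

/-- Partial derivative with respect to `r`. -/
noncomputable def pd_r (F : HeisObs) (r θ₁ θ₂ θ₃ p_r p₁ p₂ p₃ : ℝ) : ℝ :=
  deriv (fun x => F x θ₁ θ₂ θ₃ p_r p₁ p₂ p₃) r

/-- Partial derivative with respect to `θ₁`. -/
noncomputable def pd_θ₁ (F : HeisObs) (r θ₁ θ₂ θ₃ p_r p₁ p₂ p₃ : ℝ) : ℝ :=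
  deriv (fun x => F r x θ₂ θ₃ p_r p₁ p₂ p₃) θ₁

/-- Partial derivative with respect to `θ₂`. -/
noncomputable def pd_θ₂ (F : HeisObs) (r θ₁ θ₂ θ₃ p_r p₁ p₂ p₃ : ℝ) : ℝ :=
  deriv (fun x => F r θ₁ x θ₃ p_r p₁ p₂ p₃) θ₂

/-- Partial derivative with respect to `θ₃`. -/
noncomputable def pd_θ₃ (F : HeisObs) (r θ₁ θ₂ θ₃ p_r p₁ p₂ p₃ : ℝ) : ℝ :=
  deriv (fun x => F r θ₁ θ₂ x p_r p₁ p₂ p₃) θ₃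

/-- Partial derivative with respect to `p_r`. -/
noncomputable def pd_pr (F : HeisObs) (r θ₁ θ₂ θ₃ p_r p₁ p₂ p₃ : ℝ) : ℝ :=
  deriv (fun x => F r θ₁ θ₂ θ₃ x p₁ p₂ p₃) p_r

/-- Partial derivative with respect to `p₁`. -/
noncomputable def pd_p₁ (F : HeisObs) (r θ₁ θ₂ θ₃ p_r p₁ p₂ p₃ : ℝ) : ℝ :=
  deriv (fun x => F r θ₁ θ₂ θ₃ p_r x p₂ p₃) p₁

/-- Partial derivative with respect to `p₂`. -/
noncomputable def pd_p₂ (F : HeisObs) (r θ₁ θ₂ θ₃ p_r p₁ p₂ p₃ : ℝ) : ℝ :=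
  deriv (fun x => F r θ₁ θ₂ θ₃ p_r p₁ x p₃) p₂

/-- Partial derivative with respect to `p₃`. -/
noncomputable def pd_p₃ (F : HeisObs) (r θ₁ θ₂ θ₃ p_r p₁ p₂ p₃ : ℝ) : ℝ :=
  deriv (fun x => F r θ₁ θ₂ θ₃ p_r p₁ p₂ x) p₃

/-- The noncanonical Poisson bracket of the reduced sub-Riemannian geodesic flow on the
second Heisenberg group `H₅`:
`{F,G} = (∂F/∂r·∂G/∂p_r − ∂F/∂p_r·∂G/∂r) + Σⱼ(∂F/∂θⱼ·∂G/∂pⱼ − ∂F/∂pⱼ·∂G/∂θⱼ)`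
`+ r·C₀·cos²θ₁·(∂F/∂p_r·∂G/∂p₂ − ∂F/∂p₂·∂G/∂p_r)`
`+ r·C₀·sin²θ₁·(∂F/∂p_r·∂G/∂p₃ − ∂F/∂p₃·∂G/∂p_r)`
`− r²·C₀·sinθ₁·cosθ₁·(∂F/∂p₁·∂G/∂p₂ − ∂F/∂p₂·∂G/∂p₁)`
`+ r²·C₀·sinθ₁·cosθ₁·(∂F/∂p₁·∂G/∂p₃ − ∂F/∂p₃·∂G/∂p₁)`. -/
noncomputable def heisBracket (C₀ : ℝ) (F G : HeisObs)
    (r θ₁ θ₂ θ₃ p_r p₁ p₂ p₃ : ℝ) : ℝ :=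
  (pd_r F r θ₁ θ₂ θ₃ p_r p₁ p₂ p₃ * pd_pr G r θ₁ θ₂ θ₃ p_r p₁ p₂ p₃
    - pd_pr F r θ₁ θ₂ θ₃ p_r p₁ p₂ p₃ * pd_r G r θ₁ θ₂ θ₃ p_r p₁ p₂ p₃)
  + (pd_θ₁ F r θ₁ θ₂ θ₃ p_r p₁ p₂ p₃ * pd_p₁ G r θ₁ θ₂ θ₃ p_r p₁ p₂ p₃
    - pd_p₁ F r θ₁ θ₂ θ₃ p_r p₁ p₂ p₃ * pd_θ₁ G r θ₁ θ₂ θ₃ p_r p₁ p₂ p₃)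
  + (pd_θ₂ F r θ₁ θ₂ θ₃ p_r p₁ p₂ p₃ * pd_p₂ G r θ₁ θ₂ θ₃ p_r p₁ p₂ p₃
    - pd_p₂ F r θ₁ θ₂ θ₃ p_r p₁ p₂ p₃ * pd_θ₂ G r θ₁ θ₂ θ₃ p_r p₁ p₂ p₃)
  + (pd_θ₃ F r θ₁ θ₂ θ₃ p_r p₁ p₂ p₃ * pd_p₃ G r θ₁ θ₂ θ₃ p_r p₁ p₂ p₃
    - pd_p₃ F r θ₁ θ₂ θ₃ p_r p₁ p₂ p₃ * pd_θ₃ G r θ₁ θ₂ θ₃ p_r p₁ p₂ p₃)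
  + r * C₀ * Real.cos θ₁ ^ 2 *
      (pd_pr F r θ₁ θ₂ θ₃ p_r p₁ p₂ p₃ * pd_p₂ G r θ₁ θ₂ θ₃ p_r p₁ p₂ p₃
        - pd_p₂ F r θ₁ θ₂ θ₃ p_r p₁ p₂ p₃ * pd_pr G r θ₁ θ₂ θ₃ p_r p₁ p₂ p₃)
  + r * C₀ * Real.sin θ₁ ^ 2 *
      (pd_pr F r θ₁ θ₂ θ₃ p_r p₁ p₂ p₃ * pd_p₃ G r θ₁ θ₂ θ₃ p_r p₁ p₂ p₃
        - pd_p₃ F r θ₁ θ₂ θ₃ p_r p₁ p₂ p₃ * pd_pr G r θ₁ θ₂ θ₃ p_r p₁ p₂ p₃)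
  - r ^ 2 * C₀ * Real.sin θ₁ * Real.cos θ₁ *
      (pd_p₁ F r θ₁ θ₂ θ₃ p_r p₁ p₂ p₃ * pd_p₂ G r θ₁ θ₂ θ₃ p_r p₁ p₂ p₃
        - pd_p₂ F r θ₁ θ₂ θ₃ p_r p₁ p₂ p₃ * pd_p₁ G r θ₁ θ₂ θ₃ p_r p₁ p₂ p₃)
  + r ^ 2 * C₀ * Real.sin θ₁ * Real.cos θ₁ *
      (pd_p₁ F r θ₁ θ₂ θ₃ p_r p₁ p₂ p₃ * pd_p₃ G r θ₁ θ₂ θ₃ p_r p₁ p₂ p₃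
        - pd_p₃ F r θ₁ θ₂ θ₃ p_r p₁ p₂ p₃ * pd_p₁ G r θ₁ θ₂ θ₃ p_r p₁ p₂ p₃)

/-- The four first integrals `Ĩ₁, Ĩ₂, Ĩ₃, Ĩ₄` of the reduced system. -/
noncomputable def heisIntegral (C₀ : ℝ) : Fin 4 → HeisObs
  | 0 => fun _r θ₁ _θ₂ _θ₃ _p_r p₁ p₂ p₃ =>
      p₁ ^ 2 + p₂ ^ 2 / Real.cos θ₁ ^ 2 + p₃ ^ 2 / Real.sin θ₁ ^ 2 - (p₂ + p₃) ^ 2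
  | 1 => fun r θ₁ _θ₂ _θ₃ _p_r _p₁ p₂ _p₃ =>
      p₂ + C₀ * r ^ 2 / 2 * Real.cos θ₁ ^ 2
  | 2 => fun r θ₁ _θ₂ _θ₃ _p_r _p₁ _p₂ p₃ =>
      p₃ + C₀ * r ^ 2 / 2 * Real.sin θ₁ ^ 2
  | 3 => fun r θ₁ _θ₂ _θ₃ p_r p₁ p₂ p₃ =>
      (1 / 2) * (p_r ^ 2 + p₁ ^ 2 / r ^ 2
        + (p₂ ^ 2 / Real.cos θ₁ ^ 2 + p₃ ^ 2 / Real.sin θ₁ ^ 2) / r ^ 2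
        - (p₂ + p₃) ^ 2 / (1 + r ^ 2))

theorem heisBracket_antisymm (C₀ : ℝ) (F G : HeisObs) (r θ₁ θ₂ θ₃ p_r p₁ p₂ p₃ : ℝ) :
    heisBracket C₀ F G r θ₁ θ₂ θ₃ p_r p₁ p₂ p₃ =
      -heisBracket C₀ G F r θ₁ θ₂ θ₃ p_r p₁ p₂ p₃ := by
  unfold heisBracket
  ring

theorem heisBracket_self (C₀ : ℝ) (F : HeisObs) (r θ₁ θ₂ θ₃ p_r p₁ p₂ p₃ : ℝ) :
    heisBracket C₀ F F r θ₁ θ₂ θ₃ p_r p₁ p₂ p₃ = 0 := by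
  unfold heisBracket
  ring

theorem hasDerivAt_cos_sq (x : ℝ) :
    HasDerivAt (fun x => Real.cos x ^ 2) (-(2 * Real.sin x * Real.cos x)) x :=
  ((Real.hasDerivAt_cos x).fun_pow 2).congr_deriv (by push_cast; ring)

theorem hasDerivAt_sin_sq (x : ℝ) :
    HasDerivAt (fun x => Real.sin x ^ 2) (2 * Real.sin x * Real.cos x) x :=
  ((Real.hasDerivAt_sin x).fun_pow 2).congr_deriv (by push_cast; ring)

/-- The angular kinetic term is differentiable in `θ₁` away from the coordinate singularities. -/
theorem hasDerivAt_angular {x : ℝ} (hc : Real.cos x ≠ 0) (hs : Real.sin x ≠ 0) (a b : ℝ) :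
    HasDerivAt (fun x => a / Real.cos x ^ 2 + b / Real.sin x ^ 2)
      (2 * a * Real.sin x / Real.cos x ^ 3 - 2 * b * Real.cos x / Real.sin x ^ 3) x := by
  refine (((hasDerivAt_const x a).fun_div (hasDerivAt_cos_sq x) (pow_ne_zero 2 hc)).fun_add
    ((hasDerivAt_const x b).fun_div (hasDerivAt_sin_sq x) (pow_ne_zero 2 hs))).congr_deriv ?_
  field_simp
  ring

/-- `Ĩ₂` generates translations in `θ₂`. -/
theorem heisBracket_heisIntegral_one (C₀ : ℝ) (G : HeisObs) (r θ₁ θ₂ θ₃ p_r p₁ p₂ p₃ : ℝ) :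
    heisBracket C₀ (heisIntegral C₀ 1) G r θ₁ θ₂ θ₃ p_r p₁ p₂ p₃ =
      -pd_θ₂ G r θ₁ θ₂ θ₃ p_r p₁ p₂ p₃ := by
  have h_r : pd_r (heisIntegral C₀ 1) r θ₁ θ₂ θ₃ p_r p₁ p₂ p₃ = C₀ * r * Real.cos θ₁ ^ 2 := by
    refine HasDerivAt.deriv ?_
    refine ((((((hasDerivAt_id' r).fun_pow 2).const_mul C₀).div_const 2).mul_const
      (Real.cos θ₁ ^ 2)).const_add p₂).congr_deriv ?_
    push_cast
    ring
  have h_θ₁ : pd_θ₁ (heisIntegral C₀ 1) r θ₁ θ₂ θ₃ p_r p₁ p₂ p₃ =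
      -(C₀ * r ^ 2 * Real.sin θ₁ * Real.cos θ₁) := by
    refine HasDerivAt.deriv ?_
    refine (((hasDerivAt_cos_sq θ₁).const_mul (C₀ * r ^ 2 / 2)).const_add p₂).congr_deriv ?_
    ring
  have h_p₂ : pd_p₂ (heisIntegral C₀ 1) r θ₁ θ₂ θ₃ p_r p₁ p₂ p₃ = 1 := by
    simp [pd_p₂, heisIntegral]
  rw [heisBracket, h_r, h_θ₁, h_p₂]
  simp only [pd_θ₂, pd_θ₃, pd_pr, pd_p₁, pd_p₃, heisIntegral, deriv_const]
  ring

/-- `Ĩ₃` generates translations in `θ₃`. -/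
theorem heisBracket_heisIntegral_two (C₀ : ℝ) (G : HeisObs) (r θ₁ θ₂ θ₃ p_r p₁ p₂ p₃ : ℝ) :
    heisBracket C₀ (heisIntegral C₀ 2) G r θ₁ θ₂ θ₃ p_r p₁ p₂ p₃ =
      -pd_θ₃ G r θ₁ θ₂ θ₃ p_r p₁ p₂ p₃ := by
  have h_r : pd_r (heisIntegral C₀ 2) r θ₁ θ₂ θ₃ p_r p₁ p₂ p₃ = C₀ * r * Real.sin θ₁ ^ 2 := by
    refine HasDerivAt.deriv ?_
    refine ((((((hasDerivAt_id' r).fun_pow 2).const_mul C₀).div_const 2).mul_const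
      (Real.sin θ₁ ^ 2)).const_add p₃).congr_deriv ?_
    push_cast
    ring
  have h_θ₁ : pd_θ₁ (heisIntegral C₀ 2) r θ₁ θ₂ θ₃ p_r p₁ p₂ p₃ =
      C₀ * r ^ 2 * Real.sin θ₁ * Real.cos θ₁ := by
    refine HasDerivAt.deriv ?_
    refine (((hasDerivAt_sin_sq θ₁).const_mul (C₀ * r ^ 2 / 2)).const_add p₃).congr_deriv ?_
    ring
  have h_p₃ : pd_p₃ (heisIntegral C₀ 2) r θ₁ θ₂ θ₃ p_r p₁ p₂ p₃ = 1 := by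
    simp [pd_p₃, heisIntegral]
  rw [heisBracket, h_r, h_θ₁, h_p₃]
  simp only [pd_θ₂, pd_θ₃, pd_pr, pd_p₁, pd_p₂, heisIntegral, deriv_const]
  ring

theorem pd_θ₂_heisIntegral (C₀ : ℝ) (i : Fin 4) (r θ₁ θ₂ θ₃ p_r p₁ p₂ p₃ : ℝ) :
    pd_θ₂ (heisIntegral C₀ i) r θ₁ θ₂ θ₃ p_r p₁ p₂ p₃ = 0 := by
  fin_cases i <;> exact deriv_const _ _

theorem pd_θ₃_heisIntegral (C₀ : ℝ) (i : Fin 4) (r θ₁ θ₂ θ₃ p_r p₁ p₂ p₃ : ℝ) :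
    pd_θ₃ (heisIntegral C₀ i) r θ₁ θ₂ θ₃ p_r p₁ p₂ p₃ = 0 := by
  fin_cases i <;> exact deriv_const _ _

theorem heisBracket_heisIntegral_zero_three (C₀ : ℝ) {r θ₁ : ℝ} (θ₂ θ₃ p_r p₁ p₂ p₃ : ℝ)
    (hr : r ≠ 0) (hc : Real.cos θ₁ ≠ 0) (hs : Real.sin θ₁ ≠ 0) :
    heisBracket C₀ (heisIntegral C₀ 0) (heisIntegral C₀ 3) r θ₁ θ₂ θ₃ p_r p₁ p₂ p₃ = 0 := by
  have f_θ₁ : pd_θ₁ (heisIntegral C₀ 0) r θ₁ θ₂ θ₃ p_r p₁ p₂ p₃ =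
      2 * p₂ ^ 2 * Real.sin θ₁ / Real.cos θ₁ ^ 3
        - 2 * p₃ ^ 2 * Real.cos θ₁ / Real.sin θ₁ ^ 3 := by
    refine HasDerivAt.deriv ?_
    convert ((hasDerivAt_angular hc hs (p₂ ^ 2) (p₃ ^ 2)).const_add (p₁ ^ 2)).sub_const
      ((p₂ + p₃) ^ 2) using 1
    ext x
    simp only [heisIntegral]
    ring
  have f_p₁ : pd_p₁ (heisIntegral C₀ 0) r θ₁ θ₂ θ₃ p_r p₁ p₂ p₃ = 2 * p₁ := by
    simp [pd_p₁, heisIntegral]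
  have f_p₂ : pd_p₂ (heisIntegral C₀ 0) r θ₁ θ₂ θ₃ p_r p₁ p₂ p₃ =
      2 * p₂ / Real.cos θ₁ ^ 2 - 2 * (p₂ + p₃) := by
    refine HasDerivAt.deriv ?_
    refine ((((((hasDerivAt_id' p₂).fun_pow 2).div_const (Real.cos θ₁ ^ 2)).const_add
      (p₁ ^ 2)).add_const (p₃ ^ 2 / Real.sin θ₁ ^ 2)).fun_sub
      (((hasDerivAt_id' p₂).add_const p₃).fun_pow 2)).congr_deriv ?_
    simp
  have f_p₃ : pd_p₃ (heisIntegral C₀ 0) r θ₁ θ₂ θ₃ p_r p₁ p₂ p₃ =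
      2 * p₃ / Real.sin θ₁ ^ 2 - 2 * (p₂ + p₃) := by
    refine HasDerivAt.deriv ?_
    refine ((((((hasDerivAt_id' p₃).fun_pow 2).div_const (Real.sin θ₁ ^ 2)).const_add
      (p₁ ^ 2 + p₂ ^ 2 / Real.cos θ₁ ^ 2))).fun_sub
      (((hasDerivAt_id' p₃).const_add p₂).fun_pow 2)).congr_deriv ?_
    simp
  have g_θ₁ : pd_θ₁ (heisIntegral C₀ 3) r θ₁ θ₂ θ₃ p_r p₁ p₂ p₃ =
      (p₂ ^ 2 * Real.sin θ₁ / Real.cos θ₁ ^ 3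
        - p₃ ^ 2 * Real.cos θ₁ / Real.sin θ₁ ^ 3) / r ^ 2 := by
    refine HasDerivAt.deriv ?_
    refine (((((hasDerivAt_angular hc hs (p₂ ^ 2) (p₃ ^ 2)).div_const (r ^ 2)).const_add
      (p_r ^ 2 + p₁ ^ 2 / r ^ 2)).sub_const ((p₂ + p₃) ^ 2 / (1 + r ^ 2))).const_mul
      (1 / 2)).congr_deriv ?_
    ring
  have g_p₁ : pd_p₁ (heisIntegral C₀ 3) r θ₁ θ₂ θ₃ p_r p₁ p₂ p₃ = p₁ / r ^ 2 := by
    simp [pd_p₁, heisIntegral]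
    ring
  have g_p₂ : pd_p₂ (heisIntegral C₀ 3) r θ₁ θ₂ θ₃ p_r p₁ p₂ p₃ =
      p₂ / Real.cos θ₁ ^ 2 / r ^ 2 - (p₂ + p₃) / (1 + r ^ 2) := by
    refine HasDerivAt.deriv ?_
    refine ((((((((hasDerivAt_id' p₂).fun_pow 2).div_const (Real.cos θ₁ ^ 2)).add_const
      (p₃ ^ 2 / Real.sin θ₁ ^ 2)).div_const (r ^ 2)).const_add (p_r ^ 2 + p₁ ^ 2 / r ^ 2)).fun_sub
      ((((hasDerivAt_id' p₂).add_const p₃).fun_pow 2).div_const (1 + r ^ 2))).const_mul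
      (1 / 2)).congr_deriv ?_
    simp
    ring
  have g_p₃ : pd_p₃ (heisIntegral C₀ 3) r θ₁ θ₂ θ₃ p_r p₁ p₂ p₃ =
      p₃ / Real.sin θ₁ ^ 2 / r ^ 2 - (p₂ + p₃) / (1 + r ^ 2) := by
    refine HasDerivAt.deriv ?_
    refine ((((((((hasDerivAt_id' p₃).fun_pow 2).div_const (Real.sin θ₁ ^ 2)).const_add
      (p₂ ^ 2 / Real.cos θ₁ ^ 2)).div_const (r ^ 2)).const_add (p_r ^ 2 + p₁ ^ 2 / r ^ 2)).fun_sub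
      ((((hasDerivAt_id' p₃).const_add p₂).fun_pow 2).div_const (1 + r ^ 2))).const_mul
      (1 / 2)).congr_deriv ?_
    simp
    ring
  have f_r : pd_r (heisIntegral C₀ 0) r θ₁ θ₂ θ₃ p_r p₁ p₂ p₃ = 0 := deriv_const _ _
  have f_pr : pd_pr (heisIntegral C₀ 0) r θ₁ θ₂ θ₃ p_r p₁ p₂ p₃ = 0 := deriv_const _ _
  rw [heisBracket, f_r, f_θ₁, f_pr, f_p₁, f_p₂, f_p₃, g_θ₁, g_p₁, g_p₂, g_p₃]
  simp only [pd_θ₂_heisIntegral, pd_θ₃_heisIntegral]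
  have hr' : 1 + r ^ 2 ≠ 0 := by positivity
  field_simp
  linear_combination 2 * C₀ * r ^ 3 * (1 + r ^ 2) * (p₂ + p₃) * Real.cos θ₁ ^ 3 *
    Real.sin θ₁ ^ 3 * pd_pr (heisIntegral C₀ 3) r θ₁ θ₂ θ₃ p_r p₁ p₂ p₃ *
    Real.sin_sq_add_cos_sq θ₁

/-- On the open set `U = {r > 0, 0 < θ₁ < π/2}`, the four first integrals
`Ĩ₁, Ĩ₂, Ĩ₃, Ĩ₄` are pairwise in involution with respect to the noncanonical Poisson
bracket: `{Ĩᵢ, Ĩⱼ} = 0` at every point of `U` for all `i, j ∈ {1,2,3,4}`. -/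
theorem heisIntegrals_involutive (C₀ : ℝ) (hC₀ : C₀ ≠ 0) (i j : Fin 4)
    (r θ₁ θ₂ θ₃ p_r p₁ p₂ p₃ : ℝ) (hr : 0 < r) (hθ₁ : 0 < θ₁) (hθ₁' : θ₁ < π / 2) :
    heisBracket C₀ (heisIntegral C₀ i) (heisIntegral C₀ j) r θ₁ θ₂ θ₃ p_r p₁ p₂ p₃ = 0 := by
  have hc : Real.cos θ₁ ≠ 0 := (Real.cos_pos_of_mem_Ioo ⟨by linarith, hθ₁'⟩).ne'
  have hs : Real.sin θ₁ ≠ 0 := (Real.sin_pos_of_pos_of_lt_pi hθ₁ (by linarith)).ne'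
  have h_one (k : Fin 4) :
      heisBracket C₀ (heisIntegral C₀ 1) (heisIntegral C₀ k) r θ₁ θ₂ θ₃ p_r p₁ p₂ p₃ = 0 := by
    rw [heisBracket_heisIntegral_one, pd_θ₂_heisIntegral, neg_zero]
  have h_two (k : Fin 4) :
      heisBracket C₀ (heisIntegral C₀ 2) (heisIntegral C₀ k) r θ₁ θ₂ θ₃ p_r p₁ p₂ p₃ = 0 := by
    rw [heisBracket_heisIntegral_two, pd_θ₃_heisIntegral, neg_zero]
  have h_zero_three :=
    heisBracket_heisIntegral_zero_three C₀ θ₂ θ₃ p_r p₁ p₂ p₃ hr.ne' hc hs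
  have h_symm {k l : Fin 4}
      (h : heisBracket C₀ (heisIntegral C₀ k) (heisIntegral C₀ l)
        r θ₁ θ₂ θ₃ p_r p₁ p₂ p₃ = 0) :
      heisBracket C₀ (heisIntegral C₀ l) (heisIntegral C₀ k)
        r θ₁ θ₂ θ₃ p_r p₁ p₂ p₃ = 0 := by
    rw [heisBracket_antisymm, h, neg_zero]
  fin_cases i
  · fin_cases j
    exacts [heisBracket_self .., h_symm (h_one 0), h_symm (h_two 0), h_zero_three]
  · exact h_one j
  · exact h_two j
  · fin_cases j
    exacts [h_symm h_zero_three, h_symm (h_one 3), h_symm (h_two 3), heisBracket_self ..]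
end
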